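/- For all types σ, τ, every a in B(στ), and every b in Bσ: the formula ↓τ(a b) ≐τ (↓_{στ} a)(↓σ b) is deducible (∅ ⊢ ↓τ(a b) ≐τ (↓_{στ} a)(↓σ b)). -/

import Mathlib

namespace PTT


/-- Simple types over a single base type `B`. -/
inductive Ty : Type
  | base : Ty
  | arrow : Ty → Ty → Ty
deriving DecidableEq

/-- Names: the constants `⊥` and `→`, and variables (an index together with a type). -/
inductive Name : Type
  | bot : Name
  | imp : Name
  | var : ℕ → Ty → Name
deriving DecidableEq

/-- The type of a name. -/
def Name.ty : Name → Ty
  | .bot => .base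
  | .imp => .arrow .base (.arrow .base .base)
  | .var _ σ => σ

/-- Terms: names, abstraction over a variable, application. -/
inductive Tm : Type
  | name : Name → Tm
  | lam : ℕ → Ty → Tm → Tm
  | app : Tm → Tm → Tm
deriving DecidableEq

/-- The term `⊥`. -/
def botTm : Tm := .name .bot

/-- The variable `(n, σ)` as a term. -/
def vr (n : ℕ) (σ : Ty) : Tm := .name (.var n σ)

/-- Implication `s → t`. -/
def impTm (s t : Tm) : Tm := .app (.app (.name .imp) s) t

/-- `⊤ := ⊥ → ⊥`. -/
def topTm : Tm := impTm botTm botTm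

/-- `¬ s := s → ⊥`. -/
def negTm (s : Tm) : Tm := impTm s botTm

/-- `s ∨ t := (s → t) → t`. -/
def orTm (s t : Tm) : Tm := impTm (impTm s t) t

/-- `s ∧ t := ¬(¬s ∨ ¬t)`. -/
def andTm (s t : Tm) : Tm := negTm (orTm (negTm s) (negTm t))

/-- `s ≡ t := (s → t) ∧ (t → s)`. -/
def equivTm (s t : Tm) : Tm := andTm (impTm s t) (impTm t s)

/-- The typing relation. -/
inductive HasTy : Tm → Ty → Prop
  | name (x : Name) : HasTy (.name x) x.ty
  | lam {n σ s τ} : HasTy s τ → HasTy (.lam n σ s) (.arrow σ τ)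
  | app {s t σ τ} : HasTy s (.arrow σ τ) → HasTy t σ → HasTy (.app s t) τ

/-- Free variables of a term. -/
def fv : Tm → Finset (ℕ × Ty)
  | .name (.var n σ) => {(n, σ)}
  | .name _ => ∅
  | .lam n σ s => (fv s).erase (n, σ)
  | .app s t => fv s ∪ fv t

/-- A term is closed if it has no free variables. -/
def Closed (s : Tm) : Prop := fv s = ∅

/-- Capture-free parallel substitution (bound variables are renamed). -/
def substAux (ρ : ℕ × Ty → Tm) : Tm → Tm
  | .name (.var n σ) => ρ (n, σ)
  | .name x => .name x
  | .app s t => .app (substAux ρ s) (substAux ρ t)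
  | .lam n σ s =>
      let used : Finset ℕ :=
        ((fv s).erase (n, σ)).biUnion (fun p => (fv (ρ p)).image Prod.fst)
      let m : ℕ := used.sup id + 1
      .lam m σ (substAux (Function.update ρ (n, σ) (vr m σ)) s)

/-- Capture-free substitution `s[(n,σ) := t]`. -/
def subst (s : Tm) (n : ℕ) (σ : Ty) (t : Tm) : Tm :=
  substAux (Function.update (fun p => vr p.1 p.2) (n, σ) t) s

/-- Contexts: terms with exactly one hole (possibly under binders). -/
inductive Ctx : Type
  | hole : Ctx
  | lam : ℕ → Ty → Ctx → Ctx
  | appL : Ctx → Tm → Ctx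
  | appR : Tm → Ctx → Ctx

/-- Filling the hole of a context with a term (capturing is allowed). -/
def Ctx.fill : Ctx → Tm → Tm
  | .hole, s => s
  | .lam n σ C, s => .lam n σ (C.fill s)
  | .appL C t, s => .app (C.fill s) t
  | .appR t C, s => .app t (C.fill s)

/-- `C` captures the variable `p` if the hole of `C` lies below a binder for `p`. -/
def Ctx.captures : Ctx → ℕ × Ty → Prop
  | .hole, _ => False
  | .lam n σ C, p => p = (n, σ) ∨ C.captures p
  | .appL C _, p => C.captures p
  | .appR _ C, p => C.captures p

/-- `C` is admissible for `A` if it captures no variable free in `A`. -/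
def Ctx.Admissible (C : Ctx) (A : Finset Tm) : Prop :=
  ∀ p ∈ A.biUnion fv, ¬ C.captures p

/-- `s` is a subterm of `t`. -/
def Subterm (s t : Tm) : Prop := ∃ C : Ctx, C.fill s = t

/-- β-redexes. -/
def IsBetaRedex : Tm → Prop
  | .app (.lam _ _ _) _ => True
  | _ => False

/-- A term is β-normal if none of its subterms is a β-redex. -/
def BetaNormal (t : Tm) : Prop := ∀ s, Subterm s t → ¬ IsBetaRedex s

/-- Lambda equivalence: the least equivalence on well-typed terms containing
α-, β-, η-conversion and closed under arbitrary contexts. -/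
inductive LamEq : Tm → Tm → Prop
  | refl {s σ} : HasTy s σ → LamEq s s
  | symm {s t} : LamEq s t → LamEq t s
  | trans {s t u} : LamEq s t → LamEq t u → LamEq s u
  | alpha {n m σ s τ} : HasTy (.lam n σ s) τ → (m, σ) ∉ fv s →
      LamEq (.lam n σ s) (.lam m σ (subst s n σ (vr m σ)))
  | beta {n σ s t τ} : HasTy (.app (.lam n σ s) t) τ →
      LamEq (.app (.lam n σ s) t) (subst s n σ t)
  | eta {n σ s τ} : HasTy (.lam n σ (.app s (vr n σ))) τ → (n, σ) ∉ fv s →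
      LamEq (.lam n σ (.app s (vr n σ))) s
  | ctx {s t σ} (C : Ctx) : LamEq s t → HasTy (C.fill s) σ → LamEq (C.fill s) (C.fill t)

/-- The standard set-theoretic interpretation of types: `B` is interpreted as the
two truth values (`Bool`), functional types as full function spaces. -/
def Ty.sem : Ty → Type
  | .base => Bool
  | .arrow σ τ => σ.sem → τ.sem

def Ty.semDefault : (σ : Ty) → σ.sem
  | .base => false
  | .arrow _ τ => fun _ => τ.semDefault

instance (σ : Ty) : Inhabited σ.sem := ⟨σ.semDefault⟩

noncomputable instance Ty.semFintype : (σ : Ty) → Fintype σ.sem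
  | .base => inferInstanceAs (Fintype Bool)
  | .arrow σ τ =>
      letI := Ty.semFintype σ
      letI := Ty.semFintype τ
      letI := Classical.decEq σ.sem
      inferInstanceAs (Fintype (σ.sem → τ.sem))

def Ty.semCast {σ τ : Ty} (h : σ = τ) (v : σ.sem) : τ.sem := h ▸ v

/-- An interpretation assigns to every variable a value of the corresponding type
(the constants `⊥` and `→` have their values fixed). -/
def Interp : Type := ℕ → (σ : Ty) → σ.sem

def Interp.update (I : Interp) (n : ℕ) (σ : Ty) (v : σ.sem) : Interp :=
  fun m τ => if h : m = n ∧ τ = σ then Ty.semCast h.2.symm v else I m τ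

/-- Type inference. -/
def typeOf : Tm → Option Ty
  | .name x => some x.ty
  | .lam _ σ s => (typeOf s).map (Ty.arrow σ)
  | .app s t =>
      match typeOf s, typeOf t with
      | some (.arrow σ τ), some σ' => if σ = σ' then some τ else none
      | _, _ => none

/-- The canonical extension `Î` of an interpretation to all terms: `eval I s σ`
is the value of `s` at type `σ` (on well-typed terms this is the usual
denotation; junk default values are used at type mismatches). -/
def eval (I : Interp) : Tm → (σ : Ty) → σ.sem
  | .name (.var n τ), σ => if h : τ = σ then Ty.semCast h (I n τ) else default
  | .name .bot, σ =>
      match σ with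
      | .base => false
      | _ => default
  | .name .imp, σ =>
      match σ with
      | .arrow .base (.arrow .base .base) => fun a b => !a || b
      | _ => default
  | .app s t, σ =>
      match typeOf t with
      | some τ => eval I s (.arrow τ σ) (eval I t τ)
      | none => default
  | .lam n τ s, σ =>
      match σ with
      | .base => default
      | .arrow σ₁ σ₂ =>
          if h : σ₁ = τ then
            fun a => eval (I.update n τ (Ty.semCast h a)) s σ₂
          else default

/-- `I` satisfies the formula `s` if `Î s = 1`. -/
def Satisfies (I : Interp) (s : Tm) : Prop := eval I s .base = true

/-- A formula is valid if every interpretation satisfies it. -/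
def ValidFml (s : Tm) : Prop := ∀ I : Interp, Satisfies I s

/-- A sequent `A ⇒ s` is valid if every interpretation satisfying `A` satisfies `s`. -/
def ValidSeq (A : Finset Tm) (s : Tm) : Prop :=
  ∀ I : Interp, (∀ t ∈ A, Satisfies I t) → Satisfies I s

/-- Finite disjunction (the empty disjunction is `⊥`). -/
def orList : List Tm → Tm
  | [] => botTm
  | [s] => s
  | s :: l => orTm s (orList l)

/-- Finite conjunction (the empty conjunction is `⊤`). -/
def andList : List Tm → Tm
  | [] => topTm
  | [s] => s
  | s :: l => andTm s (andList l)

/-- The argument types of a type (every type has the form `σ₁…σₙB`). -/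
def Ty.args : Ty → List Ty
  | .base => []
  | .arrow σ τ => σ :: τ.args

/-- Tuples of values along a list of types. -/
def Tup : List Ty → Type
  | [] => PUnit
  | σ :: l => σ.sem × Tup l

noncomputable instance TupFintype : (l : List Ty) → Fintype (Tup l)
  | [] => inferInstanceAs (Fintype PUnit)
  | σ :: l =>
      letI := TupFintype l
      inferInstanceAs (Fintype (σ.sem × Tup l))

/-- Applying a function value to a tuple of arguments (the result type is `B`). -/
def Ty.applyTup : (σ : Ty) → σ.sem → Tup σ.args → Bool
  | .base, a, _ => a
  | .arrow _ τ, f, p => τ.applyTup (f p.1) p.2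

/-- Quote/identity data for each type in a list: a quote function and the term `≐`. -/
def ArgData : List Ty → Type
  | [] => PUnit
  | σ :: l => ((σ.sem → Tm) × Tm) × ArgData l

/-- The conjunction list `x_k ≐_{σ_k} (↓_{σ_k} b_k), …` for a tuple `b`. -/
def eqConj : (l : List Ty) → ArgData l → ℕ → Tup l → List Tm
  | [], _, _, _ => []
  | σ :: l, (d, ds), k, (b, bs) =>
      (.app (.app d.2 (vr k σ)) (d.1 b)) :: eqConj l ds (k + 1) bs

/-- `λ x_k : σ_k. …` binding one variable for each type in the list. -/
def mkLams : (l : List Ty) → ℕ → Tm → Tm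
  | [], _, body => body
  | σ :: l, k, body => .lam k σ (mkLams l (k + 1) body)

/-- The body of the quote term
`↓_{σ₁…σₙB} a := λx₁…xₙ. ⋁_{b₁…bₙ, a b₁…bₙ = 1} ⋀_j x_j ≐_{σ_j} (↓_{σ_j} b_j)`. -/
noncomputable def quoteBodyAux (σ : Ty) (ad : ArgData σ.args) (a : σ.sem) : Tm :=
  mkLams σ.args 0 (orList
    ((((Finset.univ : Finset (Tup σ.args)).toList.filter
        (fun b => σ.applyTup a b))).map
      (fun b => andList (eqConj σ.args ad 0 b))))

/-- `∀σ := λf. ⋀_{a ∈ Bσ} f (↓σ a)`, given the quote function for `σ`. -/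
noncomputable def allTmAux (σ : Ty) (q : σ.sem → Tm) : Tm :=
  .lam 0 (.arrow σ .base)
    (andList (((Finset.univ : Finset σ.sem).toList).map
      (fun a => .app (vr 0 (.arrow σ .base)) (q a))))

mutual
  /-- The quote function `↓σ` together with the identity term `≐σ`. -/
  noncomputable def quoteEq : (σ : Ty) → ((σ.sem → Tm) × Tm)
    | .base =>
        (fun a => quoteBodyAux .base PUnit.unit a,
         .lam 0 .base (.lam 1 .base (equivTm (vr 0 .base) (vr 1 .base))))
    | .arrow σ τ =>
        (fun a => quoteBodyAux (.arrow σ τ) ((quoteEq σ, argData τ) : ArgData (σ :: τ.args)) a,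
         .lam 0 (.arrow σ τ) (.lam 1 (.arrow σ τ)
           (.app (allTmAux σ (quoteEq σ).1)
             (.lam 2 σ
               (.app (.app (quoteEq τ).2
                  (.app (vr 0 (.arrow σ τ)) (vr 2 σ)))
                (.app (vr 1 (.arrow σ τ)) (vr 2 σ)))))))
  /-- Quote/identity data for all argument types of a type. -/
  noncomputable def argData : (σ : Ty) → ArgData σ.args
    | .base => PUnit.unit
    | .arrow σ τ => ((quoteEq σ, argData τ) : ArgData (σ :: τ.args))
end

/-- The quote function `↓σ : Bσ → Λ`. -/
noncomputable def quote (σ : Ty) (a : σ.sem) : Tm := (quoteEq σ).1 a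

/-- The term `≐σ : σσB` denoting the identity predicate on `Bσ`. -/
noncomputable def eqTm (σ : Ty) : Tm := (quoteEq σ).2

/-- The term `∀σ : (σB)B`. -/
noncomputable def allTm (σ : Ty) : Tm := allTmAux σ (quote σ)


/-- Propositional formulas: `s ::= x | ⊥ | s → s` with `x` a variable of type `B`. -/
inductive Propositional : Tm → Prop
  | var (n : ℕ) : Propositional (vr n .base)
  | bot : Propositional botTm
  | imp {s t} : Propositional s → Propositional t → Propositional (impTm s t)

/-- A type-respecting substitution of terms for variables. -/
def IsSubstitution (ρ : ℕ × Ty → Tm) : Prop := ∀ n σ, HasTy (ρ (n, σ)) σ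

/-- A formula is tautologous if it is a substitution instance of a tautology
(a valid propositional formula). -/
def Tautologous (s : Tm) : Prop :=
  ∃ t ρ, Propositional t ∧ ValidFml t ∧ IsSubstitution ρ ∧ s = substAux ρ t

/-- The proof system: Triv, Weak, Ded, MP, DN, Lam and Boolean replacement (BR).
Sequents consist of a finite set of formulas and a formula. -/
inductive Ded : Finset Tm → Tm → Prop
  | triv {A s} : (∀ t ∈ A, HasTy t .base) → HasTy s .base → Ded (insert s A) s
  | weak {A s t} : HasTy s .base → Ded A t → Ded (insert s A) t
  | ded {A s t} : Ded (insert s A) t → Ded A (impTm s t)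
  | mp {A s t} : Ded A (impTm s t) → Ded A s → Ded A t
  | dn {A s} : Ded A (negTm (negTm s)) → Ded A s
  | lam {A s t} : Ded A s → LamEq s t → HasTy t .base → Ded A t
  | br {A s t} (C : Ctx) : C.Admissible A → Ded A (equivTm s t) →
      Ded A (C.fill s) → HasTy (C.fill t) .base → Ded A (C.fill t)


/-! ### Typing and free variables -/

theorem HasTy.typeOf_eq {s : Tm} {σ : Ty} (h : HasTy s σ) : typeOf s = some σ := by
  induction h with
  | name x => rfl
  | lam _ ih => simp [typeOf, ih]
  | app _ _ ih₁ ih₂ => simp [typeOf, ih₁, ih₂]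

theorem hasTy_vr (n : ℕ) (σ : Ty) : HasTy (vr n σ) σ := HasTy.name (.var n σ)

theorem hasTy_bot : HasTy botTm .base := HasTy.name .bot

theorem hasTy_imp {s t : Tm} (hs : HasTy s .base) (ht : HasTy t .base) :
    HasTy (impTm s t) .base := .app (.app (HasTy.name .imp) hs) ht

theorem hasTy_top : HasTy topTm .base := hasTy_imp hasTy_bot hasTy_bot

theorem hasTy_neg {s : Tm} (hs : HasTy s .base) : HasTy (negTm s) .base :=
  hasTy_imp hs hasTy_bot

theorem hasTy_or {s t : Tm} (hs : HasTy s .base) (ht : HasTy t .base) :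
    HasTy (orTm s t) .base := hasTy_imp (hasTy_imp hs ht) ht

theorem hasTy_and {s t : Tm} (hs : HasTy s .base) (ht : HasTy t .base) :
    HasTy (andTm s t) .base := hasTy_neg (hasTy_or (hasTy_neg hs) (hasTy_neg ht))

theorem hasTy_equiv {s t : Tm} (hs : HasTy s .base) (ht : HasTy t .base) :
    HasTy (equivTm s t) .base := hasTy_and (hasTy_imp hs ht) (hasTy_imp ht hs)

theorem hasTy_orList {l : List Tm} (h : ∀ s ∈ l, HasTy s .base) : HasTy (orList l) .base := by
  induction l using orList.induct with
  | case1 => exact hasTy_bot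
  | case2 s => exact h s (by simp)
  | case3 s l hl ih =>
    rw [orList]
    · exact hasTy_or (h s (by simp)) (ih fun t ht => h t (by simp [ht]))
    · exact hl

theorem hasTy_andList {l : List Tm} (h : ∀ s ∈ l, HasTy s .base) :
    HasTy (andList l) .base := by
  induction l using andList.induct with
  | case1 => exact hasTy_top
  | case2 s => exact h s (by simp)
  | case3 s l hl ih =>
    rw [andList]
    · exact hasTy_and (h s (by simp)) (ih fun t ht => h t (by simp [ht]))
    · exact hl

@[simp] theorem fv_vr (n : ℕ) (σ : Ty) : fv (vr n σ) = {(n, σ)} := rfl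

@[simp] theorem fv_app (s t : Tm) : fv (.app s t) = fv s ∪ fv t := rfl

@[simp] theorem fv_lam (n : ℕ) (σ : Ty) (s : Tm) : fv (.lam n σ s) = (fv s).erase (n, σ) := rfl

@[simp] theorem fv_bot : fv botTm = ∅ := rfl

@[simp] theorem fv_imp (s t : Tm) : fv (impTm s t) = fv s ∪ fv t := by
  simp [impTm, fv]

@[simp] theorem fv_and (s t : Tm) : fv (andTm s t) = fv s ∪ fv t := by
  ext; simp [andTm, orTm, negTm]

theorem fv_orList_subset {l : List Tm} {S : Finset (ℕ × Ty)} (h : ∀ s ∈ l, fv s ⊆ S) :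
    fv (orList l) ⊆ S := by
  induction l using orList.induct with
  | case1 => simp [orList]
  | case2 s => exact h s (by simp)
  | case3 s l hl ih =>
    have := ih fun t ht => h t (by simp [ht])
    have := h s (by simp)
    rw [orList]
    · simp only [orTm, fv_imp, Finset.union_subset_iff]; tauto
    · exact hl

theorem fv_andList_subset {l : List Tm} {S : Finset (ℕ × Ty)} (h : ∀ s ∈ l, fv s ⊆ S) :
    fv (andList l) ⊆ S := by
  induction l using andList.induct with
  | case1 => simp [andList, topTm]
  | case2 s => exact h s (by simp)
  | case3 s l hl ih =>
    have := ih fun t ht => h t (by simp [ht])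
    have := h s (by simp)
    rw [andList]
    · simp only [fv_and, Finset.union_subset_iff]; tauto
    · exact hl

/-! ### Parallel substitution -/

/-- The index chosen by `substAux ρ` for the bound variable of `λ (n, σ). s`. -/
def freshIdx (ρ : ℕ × Ty → Tm) (n : ℕ) (σ : Ty) (s : Tm) : ℕ :=
  (((fv s).erase (n, σ)).biUnion (fun p => (fv (ρ p)).image Prod.fst)).sup id + 1

theorem substAux_lam (ρ : ℕ × Ty → Tm) (n : ℕ) (σ : Ty) (s : Tm) :
    substAux ρ (.lam n σ s) = .lam (freshIdx ρ n σ s) σ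
      (substAux (Function.update ρ (n, σ) (vr (freshIdx ρ n σ s) σ)) s) := rfl

theorem freshIdx_notMem {ρ : ℕ × Ty → Tm} {n : ℕ} {σ : Ty} {s : Tm} {p : ℕ × Ty}
    (hp : p ∈ (fv s).erase (n, σ)) : (freshIdx ρ n σ s, σ) ∉ fv (ρ p) := by
  intro h
  have hmem : freshIdx ρ n σ s ∈
      ((fv s).erase (n, σ)).biUnion (fun p => (fv (ρ p)).image Prod.fst) :=
    Finset.mem_biUnion.2 ⟨p, hp, Finset.mem_image.2 ⟨_, h, rfl⟩⟩
  have hle := Finset.le_sup (f := id) hmem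
  simp only [id, freshIdx] at hle
  omega

theorem substAux_congr {s : Tm} {ρ θ : ℕ × Ty → Tm} (h : ∀ p ∈ fv s, ρ p = θ p) :
    substAux ρ s = substAux θ s := by
  induction s generalizing ρ θ with
  | name x =>
    cases x with
    | var n σ => exact h (n, σ) (by simp [fv])
    | _ => rfl
  | app s t ihs iht =>
    simp only [substAux]
    rw [ihs fun p hp => h p (by simp [hp]), iht fun p hp => h p (by simp [hp])]
  | lam n σ s ih =>
    have hm : freshIdx ρ n σ s = freshIdx θ n σ s := by
      unfold freshIdx
      congr 2
      exact Finset.biUnion_congr rfl fun p hp => by rw [h p hp]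
    rw [substAux_lam, substAux_lam, hm]
    congr 1
    apply ih
    intro p hp
    by_cases hpn : p = (n, σ)
    · simp [hpn]
    · simpa [hpn] using h p (by simp [hp, hpn])

theorem fv_substAux (ρ : ℕ × Ty → Tm) (s : Tm) :
    fv (substAux ρ s) = (fv s).biUnion fun p => fv (ρ p) := by
  induction s generalizing ρ with
  | name x => cases x <;> simp [substAux, fv]
  | app s t ihs iht => simp [substAux, ihs, iht, Finset.union_biUnion]
  | lam n σ s ih =>
    rw [substAux_lam, fv_lam, ih]
    ext q
    simp only [Finset.mem_erase, Finset.mem_biUnion, fv_lam]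
    constructor
    · rintro ⟨hq, p, hp, hqp⟩
      by_cases hpn : p = (n, σ)
      · simp [hpn] at hqp; exact absurd hqp hq
      · exact ⟨p, ⟨hpn, hp⟩, by simpa [hpn] using hqp⟩
    · rintro ⟨p, ⟨hpn, hp⟩, hqp⟩
      refine ⟨?_, p, hp, by simpa [hpn] using hqp⟩
      rintro rfl
      exact freshIdx_notMem (Finset.mem_erase.2 ⟨hpn, hp⟩) hqp

/-- Since bound variables are renamed canonically, substitutions compose on the nose. -/
theorem substAux_substAux (ρ θ : ℕ × Ty → Tm) (s : Tm) :
    substAux ρ (substAux θ s) = substAux (fun p => substAux ρ (θ p)) s := by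
  induction s generalizing ρ θ with
  | name x => cases x <;> rfl
  | app s t ihs iht => simp only [substAux, ihs, iht]
  | lam n σ s ih =>
    have hk : freshIdx ρ (freshIdx θ n σ s) σ
          (substAux (Function.update θ (n, σ) (vr (freshIdx θ n σ s) σ)) s) =
        freshIdx (fun p => substAux ρ (θ p)) n σ s := by
      rw [freshIdx, ← fv_lam, ← substAux_lam, fv_substAux, fv_lam, Finset.biUnion_biUnion,
        freshIdx]
      congr 2
      refine Finset.biUnion_congr rfl fun p _ => ?_
      rw [fv_substAux, Finset.biUnion_image]
    rw [substAux_lam θ, substAux_lam ρ, hk, substAux_lam, ih]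
    congr 1
    apply substAux_congr
    intro p hp
    by_cases hpn : p = (n, σ)
    · simp [hpn, vr, substAux]
    · simp only [Function.update_of_ne hpn]
      apply substAux_congr
      intro q hq
      rw [Function.update_of_ne]
      rintro rfl
      exact freshIdx_notMem (Finset.mem_erase.2 ⟨hpn, hp⟩) hq

theorem HasTy.substAux {s : Tm} {σ : Ty} (hs : HasTy s σ) {ρ : ℕ × Ty → Tm}
    (h : ∀ p ∈ fv s, HasTy (ρ p) p.2) : HasTy (substAux ρ s) σ := by
  induction hs generalizing ρ with
  | name x =>
    cases x with
    | var n σ => exact h (n, σ) (by simp [fv])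
    | bot => exact HasTy.name _
    | imp => exact HasTy.name _
  | app _ _ ih₁ ih₂ =>
    exact .app (ih₁ fun p hp => h p (by simp [hp])) (ih₂ fun p hp => h p (by simp [hp]))
  | @lam n σ s τ _ ih =>
    rw [substAux_lam]
    refine .lam (ih fun p hp => ?_)
    by_cases hpn : p = (n, σ)
    · subst hpn; simpa using hasTy_vr _ σ
    · simpa [hpn] using h p (by simp [hp, hpn])

/-! ### Lambda equivalence -/

theorem LamEq.app {s s' t t' : Tm} {σ τ : Ty} (hs : LamEq s s') (ht : LamEq t t')
    (hty : HasTy (.app s t) τ) (hs' : HasTy s' (.arrow σ τ)) (htσ : HasTy t σ) :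
    LamEq (.app s t) (.app s' t') :=
  (LamEq.ctx (.appL .hole t) hs hty).trans (LamEq.ctx (.appR s' .hole) ht (.app hs' htσ))

theorem lamEq_substAux_vr {s : Tm} {σ : Ty} (hs : HasTy s σ) :
    LamEq s (substAux (fun p => vr p.1 p.2) s) := by
  induction hs with
  | name x => cases x <;> exact LamEq.refl (HasTy.name _)
  | app h₁ h₂ ih₁ ih₂ =>
    exact ih₁.app ih₂ (.app h₁ h₂) (h₁.substAux fun p _ => hasTy_vr _ _) h₂
  | @lam n σ s τ h ih =>
    rw [substAux_lam]
    by_cases hn : freshIdx (fun p => vr p.1 p.2) n σ s = n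
    · rw [hn, Function.update_eq_self_iff.2 rfl]
      exact LamEq.ctx (.lam n σ .hole) ih (.lam h)
    · refine LamEq.alpha (.lam h) fun hm => ?_
      have hne : (freshIdx (fun p => vr p.1 p.2) n σ s, σ) ≠ (n, σ) := by simpa using hn
      exact freshIdx_notMem (ρ := fun p => vr p.1 p.2) (Finset.mem_erase.2 ⟨hne, hm⟩) (by simp)

/-! ### Denotation of terms -/

theorem eval_var (I : Interp) (n : ℕ) (σ : Ty) : eval I (vr n σ) σ = I n σ := by
  exact dif_pos rfl

theorem eval_app (I : Interp) {s t : Tm} {σ τ : Ty} (ht : HasTy t σ) :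
    eval I (.app s t) τ = eval I s (.arrow σ τ) (eval I t σ) := by
  change (match typeOf t with
    | some τ' => eval I s (.arrow τ' τ) (eval I t τ')
    | none => default) = _
  rw [ht.typeOf_eq]

theorem eval_lam (I : Interp) (n : ℕ) (σ τ : Ty) (s : Tm) (a : σ.sem) :
    eval I (.lam n σ s) (.arrow σ τ) a = eval (I.update n σ a) s τ := by
  exact congrFun (dif_pos rfl) a

@[simp] theorem Interp.update_self (I : Interp) (n : ℕ) (σ : Ty) (v : σ.sem) :
    I.update n σ v n σ = v := by
  simp [Interp.update, Ty.semCast]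

theorem Interp.update_of_ne (I : Interp) {n m : ℕ} {σ τ : Ty} (v : σ.sem)
    (h : (m, τ) ≠ (n, σ)) : I.update n σ v m τ = I m τ := by
  have : ¬ (m = n ∧ τ = σ) := by simpa using h
  simp [Interp.update, this]

theorem satisfies_imp (I : Interp) {s t : Tm} (hs : HasTy s .base) (ht : HasTy t .base) :
    Satisfies I (impTm s t) ↔ (Satisfies I s → Satisfies I t) := by
  have h : eval I (impTm s t) .base = (!(eval I s .base : Bool) || (eval I t .base : Bool)) := by
    rw [impTm, eval_app I ht, eval_app I hs]; rfl
  unfold Satisfies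
  rw [h]
  have key : ∀ x y : Bool, (!x || y) = true ↔ (x = true → y = true) := by decide
  exact key _ _

theorem not_satisfies_bot (I : Interp) : ¬ Satisfies I botTm := by
  exact Bool.false_ne_true

theorem satisfies_or (I : Interp) {s t : Tm} (hs : HasTy s .base) (ht : HasTy t .base) :
    Satisfies I (orTm s t) ↔ (Satisfies I s ∨ Satisfies I t) := by
  rw [orTm, satisfies_imp I (hasTy_imp hs ht) ht, satisfies_imp I hs ht]
  tauto

theorem satisfies_neg (I : Interp) {s : Tm} (hs : HasTy s .base) :
    Satisfies I (negTm s) ↔ ¬ Satisfies I s := by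
  rw [negTm, satisfies_imp I hs hasTy_bot]
  have := not_satisfies_bot I
  tauto

theorem satisfies_and (I : Interp) {s t : Tm} (hs : HasTy s .base) (ht : HasTy t .base) :
    Satisfies I (andTm s t) ↔ (Satisfies I s ∧ Satisfies I t) := by
  rw [andTm, satisfies_neg I (hasTy_or (hasTy_neg hs) (hasTy_neg ht)),
    satisfies_or I (hasTy_neg hs) (hasTy_neg ht), satisfies_neg I hs, satisfies_neg I ht]
  tauto

theorem satisfies_equiv (I : Interp) {s t : Tm} (hs : HasTy s .base) (ht : HasTy t .base) :
    Satisfies I (equivTm s t) ↔ (Satisfies I s ↔ Satisfies I t) := by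
  rw [equivTm, satisfies_and I (hasTy_imp hs ht) (hasTy_imp ht hs), satisfies_imp I hs ht,
    satisfies_imp I ht hs]
  tauto

theorem satisfies_orList (I : Interp) {l : List Tm} (h : ∀ s ∈ l, HasTy s .base) :
    Satisfies I (orList l) ↔ ∃ s ∈ l, Satisfies I s := by
  induction l using orList.induct with
  | case1 => simpa [orList] using not_satisfies_bot I
  | case2 s => simp [orList]
  | case3 s l hl ih =>
    have hl' : ∀ t ∈ l, HasTy t .base := fun t ht => h t (by simp [ht])
    rw [orList]
    · rw [satisfies_or I (h s (by simp)) (hasTy_orList hl'), ih hl']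
      simp
    · exact hl

theorem satisfies_andList (I : Interp) {l : List Tm} (h : ∀ s ∈ l, HasTy s .base) :
    Satisfies I (andList l) ↔ ∀ s ∈ l, Satisfies I s := by
  induction l using andList.induct with
  | case1 => simp [andList, topTm, satisfies_imp I hasTy_bot hasTy_bot]
  | case2 s => simp [andList]
  | case3 s l hl ih =>
    have hl' : ∀ t ∈ l, HasTy t .base := fun t ht => h t (by simp [ht])
    rw [andList]
    · rw [satisfies_and I (h s (by simp)) (hasTy_andList hl'), ih hl']
      simp
    · exact hl

/-! ### Completeness for closed formulas -/

/-- The logical relation between terms and values: a formula is related to a truth value if it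
is provable or refutable accordingly; related functions send related arguments to related
results. -/
def Realizes : (σ : Ty) → Tm → σ.sem → Prop
  | .base, s, a => HasTy s .base ∧ (a = true → Ded ∅ s) ∧ (a = false → Ded ∅ (negTm s))
  | .arrow σ τ, s, f => HasTy s (.arrow σ τ) ∧
      ∀ t a, Realizes σ t a → Realizes τ (.app s t) (f a)

theorem Realizes.hasTy {σ : Ty} {s : Tm} {a : σ.sem} (h : Realizes σ s a) : HasTy s σ := by
  cases σ <;> exact h.1

theorem Realizes.of_lamEq {σ : Ty} {s t : Tm} {a : σ.sem} (h : Realizes σ s a)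
    (hst : LamEq s t) (ht : HasTy t σ) : Realizes σ t a := by
  induction σ generalizing s t with
  | base =>
    refine ⟨ht, fun ha => (h.2.1 ha).lam hst ht, fun ha => (h.2.2 ha).lam ?_ (hasTy_neg ht)⟩
    exact LamEq.ctx (.appL (.appR (.name .imp) .hole) botTm) hst (hasTy_neg h.hasTy)
  | arrow σ τ _ ihτ =>
    exact ⟨ht, fun u b hu => ihτ (h.2 u b hu)
      (LamEq.ctx (.appL .hole u) hst (.app h.hasTy hu.hasTy)) (.app ht hu.hasTy)⟩

theorem Ded.hyp {s : Tm} (hs : HasTy s .base) : Ded {s} s := by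
  simpa using Ded.triv (A := ∅) (by simp) hs

theorem Ded.weak_empty {s t : Tm} (hs : HasTy s .base) (h : Ded ∅ t) : Ded {s} t := by
  simpa using Ded.weak hs h

theorem realizes_imp (I : Interp) :
    Realizes _ (.name .imp) (eval I (.name .imp) (.arrow .base (.arrow .base .base))) := by
  refine ⟨HasTy.name .imp, fun s a hs => ⟨.app (HasTy.name .imp) hs.hasTy, fun t b ht => ?_⟩⟩
  have hsty := hs.hasTy
  have htty := ht.hasTy
  have hst := hasTy_imp hsty htty
  change Realizes .base (impTm s t) ((!(a : Bool) || (b : Bool) : Bool))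
  obtain ⟨-, hs₁, hs₀⟩ := hs
  obtain ⟨-, ht₁, ht₀⟩ := ht
  change Bool at a b
  refine ⟨hst, fun hab => ?_, fun hab => ?_⟩
  · apply Ded.ded
    rw [insert_empty_eq]
    cases b with
    | true => exact (ht₁ rfl).weak_empty hsty
    | false =>
      have ha : a = false := (Bool.not_eq_true' a).mp ((Bool.or_false _).symm.trans hab)
      exact .dn (.ded (.weak (hasTy_neg htty) (.mp ((hs₀ ha).weak_empty hsty) (.hyp hsty))))
  · have key : ∀ x y : Bool, (!x || y) = false → x = true ∧ y = false := by decide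
    have hab' : a = true ∧ b = false := key a b hab
    apply Ded.ded
    rw [insert_empty_eq]
    exact .mp ((ht₀ hab'.2).weak_empty hst)
      (.mp (.hyp hst) ((hs₁ hab'.1).weak_empty hst))

theorem realizes_substAux {s : Tm} {σ : Ty} (hs : HasTy s σ) (I : Interp) (ρ : ℕ × Ty → Tm)
    (h : ∀ p ∈ fv s, Realizes p.2 (ρ p) (I p.1 p.2)) :
    Realizes σ (substAux ρ s) (eval I s σ) := by
  induction hs generalizing I ρ with
  | name x =>
    cases x with
    | var n σ =>
      have := eval_var I n σ
      simp only [vr] at this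
      simp only [Name.ty, substAux]
      rw [this]
      exact h (n, σ) (by simp [fv])
    | bot =>
      refine ⟨hasTy_bot, fun ha => absurd ha (not_satisfies_bot I), fun _ => ?_⟩
      exact .ded (by rw [insert_empty_eq]; exact .hyp hasTy_bot)
    | imp => exact realizes_imp I
  | @app s t σ τ _ ht ih₁ ih₂ =>
    rw [eval_app I ht]
    exact (ih₁ I ρ fun p hp => h p (by simp [hp])).2 _ _
      (ih₂ I ρ fun p hp => h p (by simp [hp]))
  | @lam n σ s τ hs ih =>
    have hty := (HasTy.lam (n := n) (σ := σ) hs).substAux fun p hp => (h p hp).hasTy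
    refine ⟨hty, fun u b hu => ?_⟩
    rw [eval_lam]
    have happ := HasTy.app hty hu.hasTy
    rw [substAux_lam] at happ ⊢
    refine Realizes.of_lamEq ?_ (LamEq.beta happ).symm happ
    rw [subst, substAux_substAux]
    apply ih
    intro p hp
    by_cases hpn : p = (n, σ)
    · subst hpn
      simpa [vr, substAux] using hu
    · have hp' := h p (by simp [hp, hpn])
      rw [Interp.update_of_ne _ _ hpn]
      simp only [Function.update_of_ne hpn]
      rw [substAux_congr (θ := fun p => vr p.1 p.2)]
      · exact hp'.of_lamEq (lamEq_substAux_vr hp'.hasTy)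
          (hp'.hasTy.substAux fun p _ => hasTy_vr _ _)
      · intro q hq
        rw [Function.update_of_ne]
        rintro rfl
        exact freshIdx_notMem (Finset.mem_erase.2 ⟨hpn, hp⟩) hq

/-- Every valid closed formula is deducible. -/
theorem ded_of_closed_of_valid {s : Tm} (hs : HasTy s .base) (hc : Closed s)
    (h : ValidFml s) : Ded ∅ s :=
  ((realizes_substAux hs (fun _ _ => default) (fun p => vr p.1 p.2)
    (by simp [show fv s = ∅ from hc])).2.1 (h _)).lam
    (lamEq_substAux_vr hs).symm hs

/-! ### Denotation of quotes and identity terms -/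

/-- `s` is a closed term of type `σ` denoting `a`. -/
def Denotes (σ : Ty) (s : Tm) (a : σ.sem) : Prop :=
  HasTy s σ ∧ fv s = ∅ ∧ ∀ I, eval I s σ = a

/-- `e` is a closed term of type `σσB` denoting identity. -/
def DenotesEq (σ : Ty) (e : Tm) : Prop :=
  HasTy e (.arrow σ (.arrow σ .base)) ∧ fv e = ∅ ∧
    ∀ I (x y : σ.sem), eval I e (.arrow σ (.arrow σ .base)) x y = true ↔ x = y

/-- Quote functions and identity terms in `ArgData` have their intended denotations. -/
def ArgData.Correct : (l : List Ty) → ArgData l → Prop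
  | [], _ => True
  | σ :: l, d => ((∀ a, Denotes σ (d.1.1 a) a) ∧ DenotesEq σ d.1.2) ∧ ArgData.Correct l d.2

/-- Updating an interpretation along the variables bound by `mkLams`. -/
def Interp.updateTup : (l : List Ty) → Interp → ℕ → Tup l → Interp
  | [], I, _, _ => I
  | σ :: l, I, k, p => Interp.updateTup l (I.update k σ p.1) (k + 1) p.2

/-- The variables bound by `mkLams`. -/
def lamVars : List Ty → ℕ → Finset (ℕ × Ty)
  | [], _ => ∅
  | σ :: l, k => insert (k, σ) (lamVars l (k + 1))

theorem Interp.updateTup_of_lt (l : List Ty) (I : Interp) {k m : ℕ} (p : Tup l) (σ : Ty)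
    (h : m < k) : I.updateTup l k p m σ = I m σ := by
  induction l generalizing I k with
  | nil => rfl
  | cons τ l ih =>
    rw [Interp.updateTup, ih _ _ (by omega), Interp.update_of_ne]
    simp; omega

theorem fv_mkLams (l : List Ty) (k : ℕ) (s : Tm) : fv (mkLams l k s) = fv s \ lamVars l k := by
  induction l generalizing k with
  | nil => simp [mkLams, lamVars]
  | cons σ l ih =>
    rw [mkLams, fv_lam, ih, lamVars]
    ext; simp; tauto

theorem hasTy_mkLams (σ : Ty) (k : ℕ) {s : Tm} (hs : HasTy s .base) :
    HasTy (mkLams σ.args k s) σ := by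
  induction σ generalizing k with
  | base => exact hs
  | arrow σ τ _ ih => exact .lam (ih _)

theorem applyTup_eval_mkLams (σ : Ty) (I : Interp) (k : ℕ) (s : Tm) (p : Tup σ.args) :
    σ.applyTup (eval I (mkLams σ.args k s) σ) p = eval (I.updateTup σ.args k p) s .base := by
  induction σ generalizing I k with
  | base => rfl
  | arrow σ τ _ ih =>
    simp only [Ty.args, mkLams, Ty.applyTup, Interp.updateTup]
    rw [eval_lam]
    exact ih _ _ _

theorem Ty.applyTup_ext (σ : Ty) {a b : σ.sem} (h : ∀ p, σ.applyTup a p = σ.applyTup b p) :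
    a = b := by
  induction σ with
  | base => exact h PUnit.unit
  | arrow σ τ _ ih => exact funext fun x => ih fun p => h (x, p)

theorem eqConj_correct (l : List Ty) (ad : ArgData l) (had : ad.Correct l) (k : ℕ)
    (b : Tup l) :
    (∀ s ∈ eqConj l ad k b, HasTy s .base ∧ fv s ⊆ lamVars l k) ∧
      ∀ I p, (∀ s ∈ eqConj l ad k b, Satisfies (Interp.updateTup l I k p) s) ↔ p = b := by
  induction l generalizing k with
  | nil => exact ⟨by simp [eqConj], fun I p => by simp [eqConj]; rfl⟩
  | cons σ l ih =>
    obtain ⟨d, ds⟩ := ad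
    obtain ⟨b, bs⟩ := b
    obtain ⟨⟨hq, he⟩, hds⟩ := had
    obtain ⟨ih₁, ih₂⟩ := ih ds hds (k + 1) bs
    have hhead : HasTy (.app (.app d.2 (vr k σ)) (d.1 b)) .base :=
      .app (.app he.1 (hasTy_vr k σ)) (hq b).1
    constructor
    · intro s hs
      rcases List.mem_cons.1 hs with rfl | hs
      · refine ⟨hhead, ?_⟩
        simp [lamVars, he.2.1, (hq b).2.1]
      · exact ⟨(ih₁ s hs).1, (ih₁ s hs).2.trans (Finset.subset_insert _ _)⟩
    · rintro I ⟨x, xs⟩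
      have hsat : ∀ J : Interp, Satisfies J (.app (.app d.2 (vr k σ)) (d.1 b)) ↔
          J k σ = b := by
        intro J
        rw [Satisfies, eval_app J (hq b).1, eval_app J (hasTy_vr k σ), (hq b).2.2, eval_var]
        exact he.2.2 J _ _
      simp only [eqConj, List.forall_mem_cons, Interp.updateTup]
      rw [hsat, ih₂, Interp.updateTup_of_lt _ _ _ _ (Nat.lt_succ_self k), Interp.update_self]
      exact Prod.mk_inj.symm

theorem denotes_quoteBodyAux (σ : Ty) (ad : ArgData σ.args) (had : ad.Correct σ.args)
    (a : σ.sem) : Denotes σ (quoteBodyAux σ ad a) a := by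
  have hc := eqConj_correct σ.args ad had 0
  have hty : ∀ b, HasTy (andList (eqConj σ.args ad 0 b)) .base := fun b =>
    hasTy_andList fun s hs => ((hc b).1 s hs).1
  refine ⟨hasTy_mkLams σ 0 (hasTy_orList ?_), ?_, fun I => σ.applyTup_ext fun p => ?_⟩
  · simp only [List.mem_map]
    rintro _ ⟨b, -, rfl⟩
    exact hty b
  · rw [quoteBodyAux, fv_mkLams, Finset.sdiff_eq_empty_iff_subset]
    apply fv_orList_subset
    simp only [List.mem_map]
    rintro _ ⟨b, -, rfl⟩
    exact fv_andList_subset fun s hs => ((hc b).1 s hs).2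
  · rw [quoteBodyAux, applyTup_eval_mkLams]
    refine Bool.eq_iff_iff.2 ?_
    change Satisfies _ _ ↔ _
    rw [satisfies_orList]
    · simp only [List.mem_map, List.mem_filter, exists_exists_and_eq_and,
        satisfies_andList _ fun s hs => ((hc _).1 s hs).1, (hc _).2]
      simp
    · simp only [List.mem_map]
      rintro _ ⟨b, -, rfl⟩
      exact hty b

theorem allTmAux_correct (σ : Ty) (q : σ.sem → Tm) (hq : ∀ a, Denotes σ (q a) a) :
    HasTy (allTmAux σ q) (.arrow (.arrow σ .base) .base) ∧ fv (allTmAux σ q) = ∅ ∧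
      ∀ I (f : σ.sem → Bool),
        eval I (allTmAux σ q) (.arrow (.arrow σ .base) .base) f = true ↔ ∀ a, f a = true := by
  have hty : ∀ s ∈ ((Finset.univ : Finset σ.sem).toList).map
      (fun a => Tm.app (vr 0 (.arrow σ .base)) (q a)), HasTy s .base := by
    simp only [List.mem_map]
    rintro _ ⟨a, -, rfl⟩
    exact .app (hasTy_vr _ _) (hq a).1
  refine ⟨.lam (hasTy_andList hty), ?_, fun I f => ?_⟩
  · have : fv (andList (((Finset.univ : Finset σ.sem).toList).map
        (fun a => Tm.app (vr 0 (.arrow σ .base)) (q a)))) ⊆ {(0, .arrow σ .base)} := by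
      apply fv_andList_subset
      simp only [List.mem_map]
      rintro _ ⟨a, -, rfl⟩
      simp [(hq a).2.1]
    rw [allTmAux, fv_lam, Finset.erase_eq_empty_iff]
    exact Finset.subset_singleton_iff.1 this
  · refine (Eq.congr_left (eval_lam I 0 (.arrow σ .base) .base _ f)).trans
      ((satisfies_andList _ hty).trans ?_)
    simp only [List.forall_mem_map, Finset.mem_toList, Finset.mem_univ, forall_true_left]
    refine forall_congr' fun a => ?_
    rw [Satisfies, eval_app _ (hq a).1, eval_var, (hq a).2.2]
    exact Eq.congr_left (congrFun (I.update_self 0 (.arrow σ .base) f) a)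

theorem denotesEq_base : DenotesEq .base (eqTm .base) := by
  rw [eqTm, quoteEq]
  refine ⟨.lam (.lam (hasTy_equiv (hasTy_vr _ _) (hasTy_vr _ _))), ?_, fun I x y => ?_⟩
  · ext p; simp [equivTm]
  · rw [eval_lam, eval_lam]
    change Satisfies _ _ ↔ _
    rw [satisfies_equiv _ (hasTy_vr _ _) (hasTy_vr _ _), Satisfies, Satisfies, eval_var,
      eval_var, Interp.update_self, Interp.update_of_ne _ _ (by simp), Interp.update_self]
    exact Bool.eq_iff_iff.symm

theorem denotesEq_arrow {σ τ : Ty} (hq : ∀ a, Denotes σ (quote σ a) a)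
    (he : DenotesEq τ (eqTm τ)) : DenotesEq (.arrow σ τ) (eqTm (.arrow σ τ)) := by
  obtain ⟨hall, hallfv, hallev⟩ := allTmAux_correct σ (quoteEq σ).1 hq
  obtain ⟨hety, hefv, heev⟩ := he
  rw [eqTm] at hety hefv heev
  have h₀ : HasTy (.app (vr 0 (.arrow σ τ)) (vr 2 σ)) τ := .app (hasTy_vr _ _) (hasTy_vr _ _)
  have h₁ : HasTy (.app (vr 1 (.arrow σ τ)) (vr 2 σ)) τ := .app (hasTy_vr _ _) (hasTy_vr _ _)
  have hbody := HasTy.lam (n := 2) (σ := σ) (.app (.app hety h₀) h₁)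
  rw [eqTm, quoteEq]
  refine ⟨.lam (.lam (.app hall hbody)), ?_, fun I x y => ?_⟩
  · ext p; simp [hallfv, hefv]; tauto
  · rw [eval_lam, eval_lam, eval_app _ hbody]
    refine (hallev _ _).trans ?_
    refine Iff.trans ?_ funext_iff.symm
    refine forall_congr' fun a => ?_
    rw [eval_lam, eval_app _ h₁, eval_app _ h₀]
    refine (heev _ _ _).trans ?_
    rw [eval_app _ (hasTy_vr _ _), eval_app _ (hasTy_vr _ _)]
    simp only [eval_var]
    simp [Interp.update_of_ne]

theorem quoteEq_argData_correct (σ : Ty) :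
    ((∀ a, Denotes σ (quote σ a) a) ∧ DenotesEq σ (eqTm σ)) ∧
      (argData σ).Correct σ.args := by
  induction σ with
  | base =>
    refine ⟨⟨fun a => ?_, denotesEq_base⟩, trivial⟩
    rw [quote, quoteEq]
    exact denotes_quoteBodyAux .base _ trivial a
  | arrow σ τ ihσ ihτ =>
    have hargs : ArgData.Correct (σ :: τ.args) (quoteEq σ, argData τ) := ⟨ihσ.1, ihτ.2⟩
    refine ⟨⟨fun a => ?_, denotesEq_arrow ihσ.1.1 ihτ.1.2⟩, ?_⟩
    · rw [quote, quoteEq]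
      exact denotes_quoteBodyAux (.arrow σ τ) _ hargs a
    · rw [argData]
      exact hargs

theorem denotes_quote (σ : Ty) (a : σ.sem) : Denotes σ (quote σ a) a :=
  (quoteEq_argData_correct σ).1.1 a

theorem denotesEq_eqTm (σ : Ty) : DenotesEq σ (eqTm σ) :=
  (quoteEq_argData_correct σ).1.2

/-- `⊢ ↓τ(a b) ≐τ (↓_{στ} a)(↓σ b)`. -/
theorem quote_app_deducible (σ τ : Ty) (a : (Ty.arrow σ τ).sem) (b : σ.sem) :
    Ded ∅ (Tm.app (Tm.app (eqTm τ) (quote τ (a b)))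
      (Tm.app (quote (.arrow σ τ) a) (quote σ b))) := by
  obtain ⟨hty₁, hfv₁, hev₁⟩ := denotes_quote τ (a b)
  obtain ⟨hty₂, hfv₂, hev₂⟩ := denotes_quote (.arrow σ τ) a
  obtain ⟨hty₃, hfv₃, hev₃⟩ := denotes_quote σ b
  obtain ⟨hty, hfv, hev⟩ := denotesEq_eqTm τ
  have happ := HasTy.app hty₂ hty₃
  refine ded_of_closed_of_valid (.app (.app hty hty₁) happ)
    (by simp [Closed, hfv, hfv₁, hfv₂, hfv₃]) fun I => ?_
  unfold Satisfies
  rw [eval_app _ happ, eval_app _ hty₁]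
  refine (hev _ _ _).2 ?_
  rw [hev₁, eval_app _ hty₃, hev₂, hev₃]

end PTT
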